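/- Let G be a graph on n vertices with maximum degree Δ and let λ > 0. Under the hard-core model at activity λ, the variance of the size of the random independent set satisfies Var(|I|) ≥ E[|I|]/(1 + (Δ+1)λ). Equivalently, (Σ_{I indep} |I|²λ^{|I|})/P_G(λ) − ((Σ_{I indep} |I|λ^{|I|})/P_G(λ))² ≥ (1/(1+(Δ+1)λ))·(Σ_{I indep} |I|λ^{|I|})/P_G(λ). -/

import Mathlib

open Finset

/- The finset of all independent sets (as finsets of vertices) of a graph `G`. -/
open Classical in
noncomputable def indepFinsets {V : Type*} [Fintype V] (G : SimpleGraph V) :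
    Finset (Finset V) :=
  Finset.univ.filter fun s => ∀ u ∈ s, ∀ v ∈ s, ¬ G.Adj u v

/- The independence polynomial `P_G(x) = Σ_{I independent} x^{|I|}`. -/
noncomputable def indepPoly {V : Type*} [Fintype V] (G : SimpleGraph V) (x : ℝ) : ℝ :=
  ∑ I ∈ indepFinsets G, x ^ I.card

/-- The vertices which can be added to `s` without destroying independence. -/
noncomputable def freeVertices {V : Type*} [Fintype V] (G : SimpleGraph V) (s : Finset V) :
    Finset V :=
  open Classical in Finset.univ.filter fun v => v ∉ s ∧ ∀ u ∈ s, ¬ G.Adj u v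

theorem mem_indepFinsets {V : Type*} [Fintype V] {G : SimpleGraph V} {s : Finset V} :
    s ∈ indepFinsets G ↔ ∀ u ∈ s, ∀ v ∈ s, ¬ G.Adj u v := by
  simp [indepFinsets]

theorem mem_freeVertices {V : Type*} [Fintype V] {G : SimpleGraph V} {s : Finset V} {v : V} :
    v ∈ freeVertices G s ↔ v ∉ s ∧ ∀ u ∈ s, ¬ G.Adj u v := by
  simp [freeVertices]

/-- Summing over pairs of an independent set and one of its members is the same as summing over
pairs of an independent set and one of its free vertices. -/
theorem sum_indepFinsets_card_mul {V : Type*} [Fintype V] [DecidableEq V] (G : SimpleGraph V)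
    (φ : Finset V → ℝ) (x : ℝ) :
    ∑ J ∈ indepFinsets G, (J.card : ℝ) * φ J * x ^ J.card =
      x * ∑ I ∈ indepFinsets G, x ^ I.card * ∑ v ∈ freeVertices G I, φ (insert v I) := by
  have h₁ : ∀ J : Finset V, (J.card : ℝ) * φ J * x ^ J.card =
      ∑ _v ∈ J, φ J * x ^ J.card := fun J => by
    rw [Finset.sum_const, nsmul_eq_mul, mul_assoc]
  simp_rw [h₁, Finset.mul_sum]
  rw [Finset.sum_sigma', Finset.sum_sigma']
  refine Finset.sum_bij' (fun p _ => ⟨p.1.erase p.2, p.2⟩) (fun p _ => ⟨insert p.2 p.1, p.2⟩)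
    ?_ ?_ ?_ ?_ ?_
  · rintro ⟨J, v⟩ h
    simp only [Finset.mem_sigma, mem_indepFinsets, mem_freeVertices, Finset.mem_erase] at h ⊢
    exact ⟨fun u hu w hw => h.1 u hu.2 w hw.2, by simp, fun u hu => h.1 u hu.2 v h.2⟩
  · rintro ⟨I, v⟩ h
    simp only [Finset.mem_sigma, mem_indepFinsets, mem_freeVertices, Finset.mem_insert] at h ⊢
    obtain ⟨hI, -, hv⟩ := h
    refine ⟨?_, by simp⟩
    rintro u (rfl | hu) w (rfl | hw)
    · exact G.loopless.irrefl _
    · exact fun h => hv w hw h.symm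
    · exact hv u hu
    · exact hI u hu w hw
  · rintro ⟨J, v⟩ h
    simp only [Finset.mem_sigma] at h
    simp [Finset.insert_erase h.2]
  · rintro ⟨I, v⟩ h
    simp only [Finset.mem_sigma, mem_freeVertices] at h
    simp [Finset.erase_insert h.2.1]
  · rintro ⟨J, v⟩ h
    simp only [Finset.mem_sigma] at h
    simp only [Finset.insert_erase h.2]
    rw [← Finset.card_erase_add_one h.2]
    ring

theorem card_freeVertices_le {V : Type*} [Fintype V] [DecidableEq V] (G : SimpleGraph V)
    [DecidableRel G.Adj] (s : Finset V) (v : V) :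
    (freeVertices G s).card ≤ (freeVertices G (insert v s)).card + (G.maxDegree + 1) := by
  have hsub : freeVertices G s ⊆
      freeVertices G (insert v s) ∪ insert v (G.neighborFinset v) := by
    intro w hw
    simp only [Finset.mem_union, mem_freeVertices, Finset.mem_insert,
      SimpleGraph.mem_neighborFinset] at hw ⊢
    by_cases h₁ : w = v
    · exact Or.inr (Or.inl h₁)
    by_cases h₂ : G.Adj v w
    · exact Or.inr (Or.inr h₂)
    refine Or.inl ⟨by tauto, ?_⟩
    rintro u (rfl | hu)
    · exact h₂
    · exact hw.2 u hu
  calc (freeVertices G s).card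
      ≤ (freeVertices G (insert v s)).card + (insert v (G.neighborFinset v)).card :=
        (Finset.card_le_card hsub).trans (Finset.card_union_le _ _)
    _ ≤ _ := by
        gcongr
        refine (Finset.card_insert_le _ _).trans ?_
        simpa using G.degree_le_maxDegree v

theorem indepPoly_pos {V : Type*} [Fintype V] (G : SimpleGraph V) {x : ℝ} (hx : 0 < x) :
    0 < indepPoly G x :=
  Finset.sum_pos (fun _ _ => pow_pos hx _) ⟨∅, mem_indepFinsets.2 (by simp)⟩

/-- For a graph `G` on `n` vertices with maximum degree `Δ` and `λ > 0`, the hard-core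
variance of `|I|` satisfies `Var(|I|) ≥ E[|I|]/(1+(Δ+1)λ)`; equivalently
`(Σ |I|²λ^{|I|})/P_G(λ) − ((Σ |I|λ^{|I|})/P_G(λ))² ≥ (1/(1+(Δ+1)λ))·(Σ |I|λ^{|I|})/P_G(λ)`. -/
theorem variance_ge_expectation_ratio {V : Type*} [Fintype V] (G : SimpleGraph V)
    [DecidableRel G.Adj] (n Δ : ℕ) (hn : Fintype.card V = n)
    (hΔ : G.maxDegree = Δ) (lam : ℝ) (hlam : 0 < lam) :
    (∑ I ∈ indepFinsets G, (I.card : ℝ) ^ 2 * lam ^ I.card) / indepPoly G lam -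
        ((∑ I ∈ indepFinsets G, (I.card : ℝ) * lam ^ I.card) / indepPoly G lam) ^ 2 ≥
      (1 / (1 + ((Δ : ℝ) + 1) * lam)) *
        ((∑ I ∈ indepFinsets G, (I.card : ℝ) * lam ^ I.card) / indepPoly G lam) := by
  classical
  set S := indepFinsets G
  set P := indepPoly G lam
  have hPpos : 0 < P := indepPoly_pos G hlam
  have hPsum : ∑ I ∈ S, lam ^ I.card = P := rfl
  set f : Finset V → ℝ := fun I => ((freeVertices G I).card : ℝ) with hf
  set M := ∑ I ∈ S, (I.card : ℝ) * lam ^ I.card with hM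
  set Q := ∑ I ∈ S, (I.card : ℝ) ^ 2 * lam ^ I.card with hQ
  set k : ℝ := ((Δ : ℝ) + 1) * lam with hk
  have hkpos : 0 < k := by positivity
  have hfree : ∑ I ∈ S, lam * f I * lam ^ I.card = M := by
    have h := sum_indepFinsets_card_mul G (fun _ => 1) lam
    simp only [mul_one, Finset.sum_const, nsmul_eq_mul] at h
    rw [hM, h, Finset.mul_sum]
    exact Finset.sum_congr rfl fun I _ => by ring
  have hmixed : ∑ I ∈ S, (I.card : ℝ) * (lam * f I) * lam ^ I.card = Q - M := by
    have h : Q = lam * ∑ I ∈ S, lam ^ I.card * (f I * (I.card + 1)) := by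
      have h := sum_indepFinsets_card_mul G (fun I => (I.card : ℝ)) lam
      simp only [← sq] at h
      rw [hQ, h]
      congr 1
      refine Finset.sum_congr rfl fun I _ => ?_
      rw [← nsmul_eq_mul, ← Finset.sum_const]
      congr 1
      refine Finset.sum_congr rfl fun v hv => ?_
      rw [Finset.card_insert_of_notMem (mem_freeVertices.1 hv).1]
      push_cast
      rfl
    rw [h, ← hfree, Finset.mul_sum, ← Finset.sum_sub_distrib]
    exact Finset.sum_congr rfl fun I _ => by ring
  have hsq : ∑ I ∈ S, (lam * f I) ^ 2 * lam ^ I.card ≤ Q - M + k * M := by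
    have h := sum_indepFinsets_card_mul G (fun I => lam * f I) lam
    rw [hmixed] at h
    rw [h, ← hfree, Finset.mul_sum, Finset.mul_sum, ← Finset.sum_add_distrib]
    refine Finset.sum_le_sum fun I _ => ?_
    have hle : f I * (lam * (f I - (Δ + 1))) ≤
        ∑ v ∈ freeVertices G I, lam * f (insert v I) := by
      rw [← nsmul_eq_mul]
      refine Finset.card_nsmul_le_sum _ _ _ fun v _ => ?_
      have hc : f I ≤ f (insert v I) + (Δ + 1) := by
        rw [← hΔ]
        simp only [hf]
        exact_mod_cast card_freeVertices_le G I v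
      gcongr
      linarith
    have hmul := mul_le_mul_of_nonneg_left hle (by positivity : 0 ≤ lam * lam ^ I.card)
    linear_combination hmul
  have hnonneg : 0 ≤ ∑ I ∈ S,
      (k * I.card + lam * f I - (k + 1) * (M / P)) ^ 2 * lam ^ I.card :=
    Finset.sum_nonneg fun I _ => by positivity
  have hexpand : ∑ I ∈ S,
      (k * I.card + lam * f I - (k + 1) * (M / P)) ^ 2 * lam ^ I.card =
      k ^ 2 * Q + 2 * k * (Q - M) + ∑ I ∈ S, (lam * f I) ^ 2 * lam ^ I.card
        - 2 * (k + 1) * (M / P) * (k * M + M) + ((k + 1) * (M / P)) ^ 2 * P := by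
    rw [← hmixed, ← hPsum]
    nth_rewrite 4 [← hfree]
    rw [hQ, hM]
    simp only [mul_add, Finset.mul_sum, ← Finset.sum_add_distrib, ← Finset.sum_sub_distrib]
    exact Finset.sum_congr rfl fun I _ => by ring
  have hMP : M / P * P = M := div_mul_cancel₀ M hPpos.ne'
  have hmain : (k + 1) * M ≤ (k + 1) * ((k + 1) * (Q - (M / P) * M)) := by
    rw [hexpand] at hnonneg
    linear_combination hnonneg + hsq + (k + 1) ^ 2 * (M / P) * hMP
  have hlin := le_of_mul_le_mul_left hmain (by positivity)
  rw [ge_iff_le, one_div, inv_mul_le_iff₀ (by positivity), div_le_iff₀ hPpos]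
  have hQP : Q / P * P = Q := div_mul_cancel₀ Q hPpos.ne'
  linear_combination hlin - (1 + k) * hQP + (1 + k) * (M / P) * hMP
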